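/- Let Ω be a compact Hausdorff space, B a C*-algebra, and φ : C(Ω, ℂ) → B a positive linear map (φ(f) is a positive element of B, i.e. φ(f) = b*b for some b ∈ B, whenever f takes only nonnegative real values). Then φ is completely positive: for every n ∈ ℕ and every positive matrix (f_{ij}) ∈ M_n(C(Ω, ℂ)) — i.e. (f_{ij}) = gᴴ·g for some g ∈ M_n(C(Ω, ℂ)), where gᴴ is the conjugate-transpose — the matrix (φ(f_{ij})) is a positive element of M_n(B), i.e. (φ(f_{ij})) = bᴴ·b for some b ∈ M_n(B), where bᴴ denotes the entrywise-star transpose. -/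

import Mathlib

open scoped ComplexOrder

universe u v

/-- A continuous function on a compact Hausdorff space is uniformly approximated by finite sums
`∑ l, u l • F l` where the `u l` are nonnegative continuous functions. -/
theorem ContinuousMap.exists_forall_norm_sub_sum_smul_le {Ω E : Type*} [TopologicalSpace Ω]
    [CompactSpace Ω] [T2Space Ω] [NormedAddCommGroup E] [NormedSpace ℝ E] (F : C(Ω, E))
    {ε : ℝ} (hε : 0 < ε) :
    ∃ (s : Finset Ω) (u : s → C(Ω, ℝ)), (∀ l x, 0 ≤ u l x) ∧
      ∀ x, ‖F x - ∑ l, u l x • F l‖ ≤ ε := by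
  have hV (t : Ω) : IsOpen {x | ‖F x - F t‖ < ε} :=
    isOpen_lt (by fun_prop) continuous_const
  obtain ⟨s, hs⟩ := isCompact_univ.elim_finite_subcover (fun t => {x | ‖F x - F t‖ < ε}) hV
    fun x _ => Set.mem_iUnion.2 ⟨x, by simpa using hε⟩
  obtain ⟨ρ, hρ⟩ := PartitionOfUnity.exists_isSubordinate isClosed_univ
    (fun l : s => {x | ‖F x - F l‖ < ε}) (fun l => hV l) (by simpa [Set.iUnion_subtype] using hs)
  refine ⟨s, ρ, fun l x => ρ.nonneg l x, fun x => ?_⟩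
  have hsum : ∑ l, ρ l x = 1 := by
    rw [← finsum_eq_sum_of_fintype]
    exact ρ.sum_eq_one (Set.mem_univ x)
  calc ‖F x - ∑ l, ρ l x • F l‖ = ‖∑ l, ρ l x • (F x - F l)‖ := by
        simp only [smul_sub, Finset.sum_sub_distrib, ← Finset.sum_smul, hsum, one_smul]
    _ ≤ ∑ l, ρ l x * ε := norm_sum_le_of_le _ fun l _ => by
        rw [norm_smul, Real.norm_of_nonneg (ρ.nonneg l x)]
        by_cases h : ρ l x = 0
        · simp [h]
        · exact mul_le_mul_of_nonneg_left (hρ l (subset_tsupport _ h)).le (ρ.nonneg l x)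
    _ = ε := by rw [← Finset.sum_mul, hsum, one_mul]

/-- A positive linear map from `C(Ω, ℂ)` to a C⋆-algebra is continuous. -/
theorem ContinuousMap.continuous_of_forall_nonneg {Ω A : Type*} [TopologicalSpace Ω]
    [CompactSpace Ω] [NonUnitalCStarAlgebra A] [PartialOrder A] [StarOrderedRing A]
    (φ : C(Ω, ℂ) →ₗ[ℂ] A) (hφ : ∀ f, 0 ≤ f → 0 ≤ φ f) : Continuous φ :=
  map_continuous (PositiveLinearMap.mk₀ φ hφ)

/-- Conjugating a positive element by a scalar matrix gives a positive matrix. -/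
theorem CStarMatrix.ofMatrix_conjTranspose_mul_smul_nonneg {m A : Type*} [Fintype m]
    [NonUnitalCStarAlgebra A] [PartialOrder A] [StarOrderedRing A] (M : Matrix m m ℂ)
    {a : A} (ha : 0 ≤ a) :
    0 ≤ CStarMatrix.ofMatrix (Matrix.of fun i j => (star M * M) i j • a) := by
  obtain ⟨c, rfl⟩ := CStarAlgebra.nonneg_iff_eq_star_mul_self.1 ha
  convert star_mul_self_nonneg (CStarMatrix.ofMatrix (Matrix.of fun i j => M i j • c))
  ext i j
  simp [CStarMatrix.mul_apply, Matrix.mul_apply, CStarMatrix.star_apply, Matrix.star_apply,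
    Finset.sum_smul, mul_comm, smul_mul_smul_comm]

/-- A nonnegative element of a C⋆-algebra has the form `star b * b`. -/
theorem NonUnitalCStarAlgebra.exists_eq_star_mul_self_of_nonneg {A : Type*}
    [NonUnitalCStarAlgebra A] [PartialOrder A] [StarOrderedRing A] {a : A} (ha : 0 ≤ a) :
    ∃ b, a = star b * b :=
  CStarAlgebra.nonneg_iff_eq_star_mul_self.1 ha

open Filter Topology in
/-- A positive linear map from `C(Ω, ℂ)` to a C⋆-algebra, applied entrywise, sends matrices of the
form `star g * g` to positive matrices. -/
theorem CStarMatrix.ofMatrix_map_star_mul_self_nonneg {Ω A m : Type*} [TopologicalSpace Ω]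
    [CompactSpace Ω] [T2Space Ω] [Fintype m]
    [NonUnitalCStarAlgebra A] [PartialOrder A] [StarOrderedRing A]
    (φ : C(Ω, ℂ) →ₗ[ℂ] A) (hφ : ∀ f, 0 ≤ f → 0 ≤ φ f) (g : Matrix m m C(Ω, ℂ)) :
    0 ≤ CStarMatrix.ofMatrix ((star g * g).map φ) := by
  have hcont := ContinuousMap.continuous_of_forall_nonneg φ hφ
  let f := star g * g
  let F : C(Ω, m → m → ℂ) := ⟨fun x i j => f i j x, by fun_prop⟩
  have hF (x : Ω) (i j : m) : F x i j = (star (g.map (· x)) * g.map (· x)) i j := by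
    simp [F, f, Matrix.mul_apply, Matrix.star_apply]
  choose s u hu happrox using fun k : ℕ =>
    F.exists_forall_norm_sub_sum_smul_le (Nat.one_div_pos_of_nat (α := ℝ) (n := k))
  let w (k : ℕ) (l : s k) : C(Ω, ℂ) := ⟨fun x => (u k l x : ℂ), by fun_prop⟩
  let G (k : ℕ) : Matrix m m C(Ω, ℂ) := Matrix.of fun i j => ∑ l : s k, F l i j • w k l
  have hG (i j : m) : Tendsto (fun k => G k i j) atTop (𝓝 (f i j)) := by
    rw [tendsto_iff_norm_sub_tendsto_zero]
    refine squeeze_zero (fun _ => norm_nonneg _) (fun k => ?_)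
      (tendsto_one_div_add_atTop_nhds_zero_nat (𝕜 := ℝ))
    rw [norm_sub_rev, ContinuousMap.norm_le _ (by positivity)]
    intro x
    refine le_trans (le_of_eq ?_)
      (((norm_le_pi_norm (_ : m → ℂ) j).trans (norm_le_pi_norm (_ : m → m → ℂ) i)).trans
        (happrox k x))
    simp [G, w, F, Finset.sum_apply, mul_comm]
  have hlim : Tendsto (fun k => CStarMatrix.ofMatrix ((G k).map φ)) atTop
      (𝓝 (CStarMatrix.ofMatrix (f.map φ))) :=
    tendsto_pi_nhds.2 fun i => tendsto_pi_nhds.2 fun j => (hcont.tendsto _).comp (hG i j)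
  refine ge_of_tendsto' hlim fun k => ?_
  have hsum : CStarMatrix.ofMatrix ((G k).map φ) = ∑ l : s k, CStarMatrix.ofMatrix
      (Matrix.of fun i j => (star (g.map (· l.1)) * g.map (· l.1)) i j • φ (w k l)) := by
    ext i j
    simp only [← hF]
    have happly : ∀ (t : Finset (s k)) (N : s k → CStarMatrix m m A),
        (∑ l ∈ t, N l) i j = ∑ l ∈ t, N l i j := fun t N =>
      Matrix.sum_apply i j t N
    simp [G, happly]
  rw [hsum]
  refine Finset.sum_nonneg fun l _ =>
    CStarMatrix.ofMatrix_conjTranspose_mul_smul_nonneg _ (hφ _ fun x => ?_)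
  simpa [w] using hu k l x

/-- **Positive maps out of commutative C*-algebras are completely positive**
(cf. Paulsen, Thm. 3.11).  Let `Ω` be a compact Hausdorff space, `B` a C*-algebra and
`φ : C(Ω, ℂ) → B` a positive linear map (i.e. `φ f` is positive — of the form `b* b` —
whenever `f` takes only nonnegative real values).  Then `φ` is completely positive: for
every `n` and every positive matrix `(f_{ij}) = gᴴ g` over `C(Ω, ℂ)`, the matrix
`(φ(f_{ij}))` is a positive element of `Mₙ(B)`, i.e. of the form `bᴴ b` with
`b ∈ Mₙ(B)`. -/
theorem positive_map_on_continuous_functions_is_completely_positive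
    {Ω : Type u} [TopologicalSpace Ω] [CompactSpace Ω] [T2Space Ω]
    {B : Type v} [NonUnitalNormedRing B] [StarRing B] [CStarRing B] [CompleteSpace B]
    [NormedSpace ℂ B] [IsScalarTower ℂ B B] [SMulCommClass ℂ B B] [StarModule ℂ B]
    (φ : C(Ω, ℂ) →ₗ[ℂ] B)
    (hpos : ∀ f : C(Ω, ℂ), (∀ t : Ω, 0 ≤ f t) → ∃ b : B, φ f = star b * b) :
    ∀ (n : ℕ) (f : Matrix (Fin n) (Fin n) C(Ω, ℂ)),
      (∃ g : Matrix (Fin n) (Fin n) C(Ω, ℂ), f = star g * g) →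
      ∃ b : Matrix (Fin n) (Fin n) B, f.map ⇑φ = star b * b := by
  rintro n _ ⟨g, rfl⟩
  let _ : NonUnitalCStarAlgebra B := {}
  let _ := CStarAlgebra.spectralOrder B
  have _ := CStarAlgebra.spectralOrderedRing B
  have hφ (f : C(Ω, ℂ)) (hf : 0 ≤ f) : 0 ≤ φ f := by
    obtain ⟨b, hb⟩ := hpos f hf
    exact hb ▸ star_mul_self_nonneg b
  exact NonUnitalCStarAlgebra.exists_eq_star_mul_self_of_nonneg
    (CStarMatrix.ofMatrix_map_star_mul_self_nonneg φ hφ g)
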